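/- arXiv:1810.04874 — 4 statements merged into one kernel-verified Lean document; each statement's English description precedes it below -/
import Mathlib

section
/- Under the standing assumptions on X, S and F: let T > 0, U₀ ∈ X, and let U, V : [0,T] → X be two mild solutions on [0,T] with initial datum U₀. Then U(t) = V(t) for all t ∈ [0,T]. -/
open MeasureTheory Filter Set Topology

/-- A mild solution on `[0,T]` with initial datum `U₀` of the semilinear equation
associated with the semigroup `S` and the nonlinearity `F`. -/
def IsMildSolution {X : Type*} [NormedAddCommGroup X] [NormedSpace ℝ X]
    (S : ℝ → X →L[ℝ] X) (F : X → X) (T : ℝ) (U₀ : X) (U : ℝ → X) : Prop :=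
  ContinuousOn U (Set.Icc 0 T) ∧
    ∀ t ∈ Set.Icc (0:ℝ) T, U t = S t U₀ + ∫ s in (0:ℝ)..t, S (t - s) (F (U s))

/-- Integral form of Grönwall's inequality with zero initial value. -/
theorem nonpos_of_le_mul_integral {φ : ℝ → ℝ} {K T : ℝ} (hT : 0 ≤ T)
    (hφ : ContinuousOn φ (Icc 0 T)) (hφ0 : ∀ t ∈ Icc 0 T, 0 ≤ φ t)
    (h : ∀ t ∈ Icc 0 T, φ t ≤ K * ∫ s in (0 : ℝ)..t, φ s) :
    ∀ t ∈ Icc 0 T, φ t ≤ 0 := by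
  set ψ : ℝ → ℝ := IccExtend hT ((Icc 0 T).domRestrict φ) with hψ
  have hψc : Continuous ψ := hφ.domRestrict.Icc_extend'
  have hψφ : ∀ t ∈ Icc 0 T, ψ t = φ t := fun t ht => by
    rw [hψ, IccExtend_of_mem hT _ ht, domRestrict_apply]
  have hint : ∀ t ∈ Icc 0 T, ∫ s in (0 : ℝ)..t, φ s = ∫ s in (0 : ℝ)..t, ψ s := fun t ht =>
    intervalIntegral.integral_congr fun s hs => by
      rw [uIcc_of_le ht.1] at hs
      exact (hψφ s ⟨hs.1, hs.2.trans ht.2⟩).symm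
  have hderiv : ∀ t, HasDerivAt (fun t => ∫ s in (0 : ℝ)..t, ψ s) (ψ t) t := fun t =>
    hψc.integral_hasStrictDerivAt 0 t |>.hasDerivAt
  have hzero := eq_zero_of_abs_deriv_le_mul_abs_self_of_eq_zero_right (K := |K|)
    (f := fun t => ∫ s in (0 : ℝ)..t, ψ s) (f' := ψ) (a := 0) (b := T)
    (fun t _ => (hderiv t).continuousAt.continuousWithinAt)
    (fun t _ => (hderiv t).hasDerivWithinAt) intervalIntegral.integral_same
    (fun t ht => by
      have ht' := Ico_subset_Icc_self ht
      rw [hψφ t ht', Real.norm_of_nonneg (hφ0 t ht'), ← hint t ht', Real.norm_eq_abs, ← abs_mul]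
      exact (h t ht').trans (le_abs_self _))
  intro t ht
  have := h t ht
  rwa [hint t ht, hzero t ht, mul_zero] at this

/-- A strongly continuous, locally bounded family of operators applied to a continuous function
is continuous. -/
theorem ContinuousOn.clm_apply_of_strong {X Y : Type*} [NormedAddCommGroup X] [NormedSpace ℝ X]
    [TopologicalSpace Y] {S : ℝ → X →L[ℝ] X} (hS : ∀ x, Continuous fun t => S t x)
    {b : ℝ → ℝ} (hb : Continuous b) (hSb : ∀ t, ‖S t‖ ≤ b t)
    {r : Y → ℝ} {g : Y → X} {A : Set Y} (hr : ContinuousOn r A) (hg : ContinuousOn g A) :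
    ContinuousOn (fun y => S (r y) (g y)) A := by
  intro y hy
  have hsmall : Tendsto (fun z => S (r z) (g z - g y)) (𝓝[A] y) (𝓝 0) := by
    refine squeeze_zero_norm (a := fun z => b (r z) * ‖g z - g y‖)
      (fun z => (S (r z)).le_of_opNorm_le (hSb _) _) ?_
    have h1 : Tendsto (fun z => b (r z)) (𝓝[A] y) (𝓝 (b (r y))) :=
      (hb.tendsto _).comp (hr y hy)
    have h2 : Tendsto (fun z => ‖g z - g y‖) (𝓝[A] y) (𝓝 0) :=
      tendsto_iff_norm_sub_tendsto_zero.1 (hg y hy)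
    simpa using h1.mul h2
  have hmain : Tendsto (fun z => S (r z) (g y)) (𝓝[A] y) (𝓝 (S (r y) (g y))) :=
    ((hS (g y)).tendsto _).comp (hr y hy)
  simpa [ContinuousWithinAt] using hsmall.add hmain

/-- A map that is Lipschitz on bounded sets is continuous. -/
theorem continuous_of_lipschitz_on_bounded {X : Type*} [NormedAddCommGroup X] {F : X → X}
    (hF : ∀ R : ℝ, 0 < R → ∃ L : ℝ, 0 ≤ L ∧
      ∀ x y : X, ‖x‖ ≤ R → ‖y‖ ≤ R → ‖F x - F y‖ ≤ L * ‖x - y‖) : Continuous F := by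
  rw [continuous_iff_continuousAt]
  intro x
  obtain ⟨L, -, hL⟩ := hF (‖x‖ + 1) (by positivity)
  have hev : ∀ᶠ y in 𝓝 x, ‖y‖ ≤ ‖x‖ + 1 :=
    (continuous_norm.tendsto x).eventually (eventually_le_nhds (lt_add_one _))
  refine tendsto_iff_norm_sub_tendsto_zero.2 (squeeze_zero' (.of_forall fun _ => norm_nonneg _)
    (hev.mono fun y hy => hL y x hy (by linarith)) ?_)
  simpa using (tendsto_iff_norm_sub_tendsto_zero.1 (tendsto_id (x := 𝓝 x))).const_mul L

theorem stmt_5 {X : Type*} [NormedAddCommGroup X] [NormedSpace ℝ X] [CompleteSpace X]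
    (S : ℝ → X →L[ℝ] X)
    (hS0 : S 0 = ContinuousLinearMap.id ℝ X)
    (hSadd : ∀ s t : ℝ, S (t + s) = (S t).comp (S s))
    (hScont : ∀ x : X, Continuous fun t => S t x)
    (M β : ℝ) (hM : 1 ≤ M) (hβ : 0 ≤ β)
    (hSbound : ∀ t : ℝ, ‖S t‖ ≤ M * Real.exp (β * |t|))
    (F : X → X)
    (hF : ∀ R : ℝ, 0 < R → ∃ L : ℝ, 0 ≤ L ∧
      ∀ x y : X, ‖x‖ ≤ R → ‖y‖ ≤ R → ‖F x - F y‖ ≤ L * ‖x - y‖)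
    (T : ℝ) (hT : 0 < T) (U₀ : X) (U V : ℝ → X)
    (hU : IsMildSolution S F T U₀ U) (hV : IsMildSolution S F T U₀ V) :
    ∀ t ∈ Set.Icc (0:ℝ) T, U t = V t := by
  obtain ⟨hUc, hUe⟩ := hU
  obtain ⟨hVc, hVe⟩ := hV
  obtain ⟨RU, hRU⟩ := isCompact_Icc.exists_bound_of_continuousOn hUc
  obtain ⟨RV, hRV⟩ := isCompact_Icc.exists_bound_of_continuousOn hVc
  obtain ⟨L, hL0, hL⟩ := hF (max 1 (max RU RV)) (by positivity)
  have hFc := continuous_of_lipschitz_on_bounded hF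
  have hint : ∀ W : ℝ → X, ContinuousOn W (Icc 0 T) → ∀ t ∈ Icc 0 T,
      IntervalIntegrable (fun s => S (t - s) (F (W s))) volume 0 t := fun W hW t ht => by
    refine ContinuousOn.intervalIntegrable_of_Icc ht.1 ?_
    exact ContinuousOn.clm_apply_of_strong hScont (b := fun t => M * Real.exp (β * |t|))
      (by fun_prop) hSbound (by fun_prop)
      (hFc.comp_continuousOn (hW.mono (Icc_subset_Icc_right ht.2)))
  have hφ : ContinuousOn (fun t => ‖U t - V t‖) (Icc 0 T) := (hUc.sub hVc).norm
  have hle : ∀ t ∈ Icc 0 T, ‖U t - V t‖ ≤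
      (M * Real.exp (β * T) * L) * ∫ s in (0 : ℝ)..t, ‖U s - V s‖ := by
    intro t ht
    rw [hUe t ht, hVe t ht, add_sub_add_left_eq_sub,
      ← intervalIntegral.integral_sub (hint U hUc t ht) (hint V hVc t ht),
      ← intervalIntegral.integral_const_mul]
    refine intervalIntegral.norm_integral_le_of_norm_le ht.1 (.of_forall fun s hs => ?_)
      ((ContinuousOn.intervalIntegrable_of_Icc ht.1
        (hφ.mono (Icc_subset_Icc_right ht.2))).const_mul _)
    have hs' : s ∈ Icc 0 T := ⟨hs.1.le, hs.2.trans ht.2⟩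
    have hS : ‖S (t - s)‖ ≤ M * Real.exp (β * T) := by
      refine (hSbound _).trans ?_
      rw [abs_of_nonneg (by linarith [hs.2])]
      gcongr
      linarith [hs.1, ht.2]
    rw [← map_sub, mul_assoc]
    refine (S (t - s)).le_of_opNorm_le_of_le hS (hL _ _ ?_ ?_)
    · exact (hRU s hs').trans ((le_max_left _ _).trans (le_max_right _ _))
    · exact (hRV s hs').trans ((le_max_right _ _).trans (le_max_right _ _))
  intro t ht
  exact sub_eq_zero.1 (norm_le_zero_iff.1
    (nonpos_of_le_mul_integral hT.le hφ (fun _ _ => norm_nonneg _) hle t ht))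
end

section
/- Let m > 0, 1 < p < 5 and α, γ > 0. Then Q'(ω) < 0 for every ω ∈ (−(m/2)√(p−1), 0) with 4(m²−ω²) > (γ−αω)², and Q'(ω) > 0 for every ω ∈ (αγ/(4+α²), αm²/γ) ∩ ((m/2)√(p−1), m) with 4(m²−ω²) > (γ−αω)². -/
open MeasureTheory Complex Filter Set Topology

/-- The inverse hyperbolic tangent, `arctanh x = ½ log((1+x)/(1−x))`. -/
noncomputable def artanh (x : ℝ) : ℝ := (1 / 2) * Real.log ((1 + x) / (1 - x))

/-- `τ(ω) = arctanh(−(γ−αω)/(2√(m²−ω²)))`. -/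
noncomputable def tauF (m α γ ω : ℝ) : ℝ :=
  artanh (-(γ - α * ω) / (2 * Real.sqrt (m ^ 2 - ω ^ 2)))

/-- The charge `Q(Φ_ω) = C₁(ω) I(ω) + C₂(ω)` of the standing wave of frequency `ω`. -/
noncomputable def QF (m p α γ : ℝ) (ω : ℝ) : ℝ :=
  (-(4 / (p - 1)) * ((p + 1) / 2) ^ (2 / (p - 1)) * ω *
        (m ^ 2 - ω ^ 2) ^ (2 / (p - 1) - 1 / 2)) *
      (∫ y in Set.Ioi (tauF m α γ ω), ((Real.cosh y)⁻¹) ^ (4 / (p - 1))) -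
    (α / 2) * ((p + 1) / 8) ^ (2 / (p - 1)) *
      (4 * (m ^ 2 - ω ^ 2) - (γ - α * ω) ^ 2) ^ (2 / (p - 1))

lemma hasDerivAt_artanh {x : ℝ} (h : x ^ 2 < 1) : HasDerivAt artanh (1 - x ^ 2)⁻¹ x := by
  obtain ⟨h₁, h₂⟩ := abs_lt.mp ((sq_lt_one_iff_abs_lt_one x).mp h)
  have h₃ : (1 + x) ≠ 0 := by linarith
  have h₄ : (1 - x) ≠ 0 := by linarith
  have h₅ : (1 - x ^ 2) ≠ 0 := by linarith
  have H := ((((hasDerivAt_id x).const_add 1).div ((hasDerivAt_id x).const_sub 1) h₄).log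
    (div_ne_zero h₃ h₄)).const_mul (1 / 2 : ℝ)
  refine H.congr_deriv ?_
  simp only [id, Pi.div_apply]
  field_simp
  ring

lemma continuous_inv_cosh_rpow (k : ℝ) : Continuous fun y : ℝ => (Real.cosh y)⁻¹ ^ k :=
  (Real.continuous_cosh.inv₀ fun y => (Real.cosh_pos y).ne').rpow_const
    fun y => Or.inl (inv_pos.mpr (Real.cosh_pos y)).ne'

lemma integrableOn_inv_cosh_rpow {k : ℝ} (hk : 0 < k) (a : ℝ) :
    IntegrableOn (fun y : ℝ => (Real.cosh y)⁻¹ ^ k) (Ioi a) := by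
  refine ((integrableOn_exp_mul_Ioi (neg_lt_zero.mpr hk) a).const_mul (2 ^ k)).mono'
    (continuous_inv_cosh_rpow k).aestronglyMeasurable (Eventually.of_forall fun y => ?_)
  have h₀ := inv_pos.mpr (Real.cosh_pos y)
  have h₁ : (Real.cosh y)⁻¹ ≤ 2 * Real.exp (-y) := by
    rw [inv_le_iff_one_le_mul₀ (Real.cosh_pos y), Real.cosh_eq]
    have : Real.exp (-y) * Real.exp y = 1 := by rw [← Real.exp_add]; simp
    nlinarith [sq_nonneg (Real.exp (-y))]
  rw [Real.norm_of_nonneg (Real.rpow_nonneg h₀.le k)]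
  calc (Real.cosh y)⁻¹ ^ k ≤ (2 * Real.exp (-y)) ^ k := Real.rpow_le_rpow h₀.le h₁ hk.le
    _ = 2 ^ k * Real.exp (-k * y) := by
      rw [Real.mul_rpow zero_le_two (Real.exp_pos _).le, ← Real.exp_mul]
      ring_nf

lemma integral_inv_cosh_rpow_pos {k : ℝ} (hk : 0 < k) (a : ℝ) :
    0 < ∫ y in Ioi a, (Real.cosh y)⁻¹ ^ k := by
  have h₀ (y : ℝ) : 0 < (Real.cosh y)⁻¹ ^ k :=
    Real.rpow_pos_of_pos (inv_pos.mpr (Real.cosh_pos y)) k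
  rw [setIntegral_pos_iff_support_of_nonneg_ae (Eventually.of_forall fun y => (h₀ y).le)
    (integrableOn_inv_cosh_rpow hk a), Function.support_eq_univ fun y => (h₀ y).ne']
  simp

lemma hasDerivAt_integral_Ioi {f : ℝ → ℝ} (hf : Continuous f) (hi : ∀ a, IntegrableOn f (Ioi a))
    (a : ℝ) : HasDerivAt (fun t => ∫ y in Ioi t, f y) (-f a) a := by
  have h : (fun t => ∫ y in Ioi t, f y) =
      fun t => (∫ y in Ioi 0, f y) - ∫ y in (0 : ℝ)..t, f y := by
    funext t
    rw [← intervalIntegral.integral_interval_add_Ioi (hi 0) (hi t)]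
    ring
  rw [h]
  exact (hf.integral_hasStrictDerivAt 0 a).hasDerivAt.const_sub _

lemma hasDerivAt_tauF {m α γ ω : ℝ} (h : (γ - α * ω) ^ 2 < 4 * (m ^ 2 - ω ^ 2)) :
    ∃ c, 0 < c ∧ HasDerivAt (tauF m α γ) (c * (α * m ^ 2 - γ * ω)) ω := by
  have hS : 0 < m ^ 2 - ω ^ 2 := by nlinarith [sq_nonneg (γ - α * ω)]
  have hr := Real.sqrt_pos.mpr hS
  have hr₂ := Real.sq_sqrt hS.le
  have hS' : HasDerivAt (fun w : ℝ => m ^ 2 - w ^ 2) (-(2 * ω)) ω := by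
    simpa using (hasDerivAt_pow 2 ω).const_sub (m ^ 2)
  have hN : HasDerivAt (fun w : ℝ => -(γ - α * w)) α ω := by
    refine (((hasDerivAt_id ω).const_mul α).const_sub γ).neg.congr_deriv ?_
    simp
  have hx : (-(γ - α * ω) / (2 * √(m ^ 2 - ω ^ 2))) ^ 2 < 1 := by
    rw [div_pow, div_lt_one (by positivity), mul_pow, hr₂]
    linarith
  have H := (hasDerivAt_artanh hx).comp ω
    (hN.div ((hS'.sqrt hS.ne').const_mul 2) (by positivity))
  refine ⟨(1 - (-(γ - α * ω) / (2 * √(m ^ 2 - ω ^ 2))) ^ 2)⁻¹ * (2 * √(m ^ 2 - ω ^ 2) ^ 3)⁻¹,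
    mul_pos (inv_pos.mpr (sub_pos.mpr hx)) (by positivity), H.congr_deriv ?_⟩
  rw [mul_assoc]
  congr 1
  have hm : m ^ 2 = √(m ^ 2 - ω ^ 2) ^ 2 + ω ^ 2 := by linarith
  generalize √(m ^ 2 - ω ^ 2) = r at *
  rw [hm]
  field_simp
  ring

lemma hasDerivAt_QF {m p α γ ω : ℝ} (hp₁ : 1 < p) (hα : 0 < α)
    (h : (γ - α * ω) ^ 2 < 4 * (m ^ 2 - ω ^ 2)) :
    ∃ a b c, 0 < a ∧ 0 < b ∧ 0 < c ∧ HasDerivAt (QF m p α γ)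
      (a * (4 * ω ^ 2 - m ^ 2 * (p - 1)) + b * (ω * (α * m ^ 2 - γ * ω)) +
        c * ((4 + α ^ 2) * ω - α * γ)) ω := by
  have hp : 0 < p - 1 := by linarith
  have hk : 0 < 4 / (p - 1) := by positivity
  have hS : 0 < m ^ 2 - ω ^ 2 := by nlinarith [sq_nonneg (γ - α * ω)]
  have hD : 0 < 4 * (m ^ 2 - ω ^ 2) - (γ - α * ω) ^ 2 := by linarith
  obtain ⟨t, ht, hτ⟩ := hasDerivAt_tauF h
  have hS' : HasDerivAt (fun w : ℝ => m ^ 2 - w ^ 2) (-(2 * ω)) ω := by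
    simpa using (hasDerivAt_pow 2 ω).const_sub (m ^ 2)
  have hD' : HasDerivAt (fun w : ℝ => 4 * (m ^ 2 - w ^ 2) - (γ - α * w) ^ 2)
      (4 * -(2 * ω) - 2 * (γ - α * ω) * -α) ω := by
    refine ((hS'.const_mul 4).sub
      ((((hasDerivAt_id ω).const_mul α).const_sub γ).pow 2)).congr_deriv ?_
    simp
  have hI := (hasDerivAt_integral_Ioi (continuous_inv_cosh_rpow (4 / (p - 1)))
    (integrableOn_inv_cosh_rpow hk) (tauF m α γ ω)).comp ω hτ
  have hI₀ := integral_inv_cosh_rpow_pos hk (tauF m α γ ω)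
  have hf : 0 < (Real.cosh (tauF m α γ ω))⁻¹ ^ (4 / (p - 1)) :=
    Real.rpow_pos_of_pos (inv_pos.mpr (Real.cosh_pos _)) _
  have hA : 0 < ((p + 1) / 2) ^ (2 / (p - 1)) := Real.rpow_pos_of_pos (by linarith) _
  have hB : 0 < ((p + 1) / 8) ^ (2 / (p - 1)) := Real.rpow_pos_of_pos (by linarith) _
  have hS₁ := Real.rpow_pos_of_pos hS (2 / (p - 1) - 1 / 2 - 1)
  have hS₀ := Real.rpow_pos_of_pos hS (2 / (p - 1) - 1 / 2)
  have hD₁ := Real.rpow_pos_of_pos hD (2 / (p - 1) - 1)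
  have hSS : (m ^ 2 - ω ^ 2) ^ (2 / (p - 1) - 1 / 2) =
      (m ^ 2 - ω ^ 2) ^ (2 / (p - 1) - 1 / 2 - 1) * (m ^ 2 - ω ^ 2) := by
    rw [Real.rpow_sub_one hS.ne']
    field_simp
  have H := ((((hasDerivAt_id ω).const_mul (-(4 / (p - 1)) * ((p + 1) / 2) ^ (2 / (p - 1)))).mul
    (hS'.rpow_const (p := 2 / (p - 1) - 1 / 2) (Or.inl hS.ne'))).mul hI).sub
    ((hD'.rpow_const (p := 2 / (p - 1)) (Or.inl hD.ne')).const_mul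
      (α / 2 * ((p + 1) / 8) ^ (2 / (p - 1))))
  refine ⟨4 / (p - 1) ^ 2 * ((p + 1) / 2) ^ (2 / (p - 1)) *
      (m ^ 2 - ω ^ 2) ^ (2 / (p - 1) - 1 / 2 - 1) *
        ∫ y in Ioi (tauF m α γ ω), (Real.cosh y)⁻¹ ^ (4 / (p - 1)),
    4 / (p - 1) * ((p + 1) / 2) ^ (2 / (p - 1)) * (m ^ 2 - ω ^ 2) ^ (2 / (p - 1) - 1 / 2) *
      (Real.cosh (tauF m α γ ω))⁻¹ ^ (4 / (p - 1)) * t,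
    α * ((p + 1) / 8) ^ (2 / (p - 1)) * (2 / (p - 1)) *
      (4 * (m ^ 2 - ω ^ 2) - (γ - α * ω) ^ 2) ^ (2 / (p - 1) - 1),
    by positivity, by positivity, by positivity, H.congr_deriv ?_⟩
  simp only [id, Function.comp_apply, Pi.mul_apply]
  rw [hSS]
  generalize (m ^ 2 - ω ^ 2) ^ (2 / (p - 1) - 1 / 2 - 1) = X
  generalize (4 * (m ^ 2 - ω ^ 2) - (γ - α * ω) ^ 2) ^ (2 / (p - 1) - 1) = Y
  generalize ((p + 1) / 8) ^ (2 / (p - 1)) = B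
  generalize ((p + 1) / 2) ^ (2 / (p - 1)) = A
  generalize (∫ y in Ioi (tauF m α γ ω), (Real.cosh y)⁻¹ ^ (4 / (p - 1))) = J
  generalize (Real.cosh (tauF m α γ ω))⁻¹ ^ (4 / (p - 1)) = F
  field_simp
  ring

theorem stmt_15 (m p α γ : ℝ) (hm : 0 < m) (hp₁ : 1 < p) (hp₅ : p < 5)
    (hα : 0 < α) (hγ : 0 < γ) :
    (∀ ω : ℝ, -(m / 2) * Real.sqrt (p - 1) < ω → ω < 0 →
      (γ - α * ω) ^ 2 < 4 * (m ^ 2 - ω ^ 2) →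
      ∃ d : ℝ, HasDerivAt (QF m p α γ) d ω ∧ d < 0) ∧
    (∀ ω : ℝ, α * γ / (4 + α ^ 2) < ω → ω < α * m ^ 2 / γ →
      m / 2 * Real.sqrt (p - 1) < ω → ω < m →
      (γ - α * ω) ^ 2 < 4 * (m ^ 2 - ω ^ 2) →
      ∃ d : ℝ, HasDerivAt (QF m p α γ) d ω ∧ 0 < d) := by
  have hp : 0 < p - 1 := by linarith
  have hq := Real.sqrt_pos.mpr hp
  have hq₂ := Real.sq_sqrt hp.le
  constructor
  · intro ω h₁ h₂ h
    obtain ⟨a, b, c, ha, hb, hc, H⟩ := hasDerivAt_QF hp₁ hα h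
    refine ⟨_, H, ?_⟩
    have e₁ : 4 * ω ^ 2 - m ^ 2 * (p - 1) < 0 := by
      rw [← hq₂]
      nlinarith [mul_pos hm hq]
    have e₂ : ω * (α * m ^ 2 - γ * ω) < 0 :=
      mul_neg_of_neg_of_pos h₂ (by nlinarith [mul_pos hα (pow_pos hm 2)])
    have e₃ : (4 + α ^ 2) * ω - α * γ < 0 := by nlinarith [mul_pos hα hγ, sq_nonneg α]
    linarith [mul_neg_of_pos_of_neg ha e₁, mul_neg_of_pos_of_neg hb e₂,
      mul_neg_of_pos_of_neg hc e₃]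
  · intro ω h₁ h₂ h₃ _ h
    obtain ⟨a, b, c, ha, hb, hc, H⟩ := hasDerivAt_QF hp₁ hα h
    refine ⟨_, H, ?_⟩
    rw [div_lt_iff₀ (by positivity)] at h₁
    rw [lt_div_iff₀ hγ] at h₂
    have hω : 0 < ω := lt_trans (by positivity) h₃
    have e₁ : 0 < 4 * ω ^ 2 - m ^ 2 * (p - 1) := by
      rw [← hq₂]
      nlinarith [mul_pos hm hq]
    have e₂ : 0 < ω * (α * m ^ 2 - γ * ω) := mul_pos hω (by linarith)
    have e₃ : 0 < (4 + α ^ 2) * ω - α * γ := by linarith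
    linarith [mul_pos ha e₁, mul_pos hb e₂, mul_pos hc e₃]
end

section
/- Let m > 0, 1 < p < 5 and α, γ < 0. Then Q'(ω) < 0 for every ω ∈ (0, (m/2)√(p−1)) ∩ (αγ/(4+α²), αm²/γ) with 4(m²−ω²) > (γ−αω)², and Q'(ω) > 0 for every ω ∈ (αm²/γ, αγ/(4+α²)) ∩ ((m/2)√(p−1), m) with 4(m²−ω²) > (γ−αω)². -/
open MeasureTheory Complex Filter Set Topology

theorem integrableOn_inv_cosh_rpow_Ioi {a : ℝ} (ha : 0 < a) (x : ℝ) :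
    IntegrableOn (fun y : ℝ => ((Real.cosh y)⁻¹) ^ a) (Set.Ioi x) := by
  have hb : IntegrableOn (fun y : ℝ => (2 : ℝ) ^ a * Real.exp (-a * y)) (Set.Ioi x) :=
    (exp_neg_integrableOn_Ioi x ha).const_mul _
  have hc : Continuous fun y : ℝ => ((Real.cosh y)⁻¹) ^ a :=
    (Real.continuous_cosh.inv₀ fun y => (Real.cosh_pos y).ne').rpow_const fun _ => Or.inr ha.le
  refine hb.mono' hc.aestronglyMeasurable (Eventually.of_forall fun y => ?_)
  have h0 : 0 < (Real.cosh y)⁻¹ := inv_pos.2 (Real.cosh_pos y)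
  have h1 : (Real.cosh y)⁻¹ ≤ 2 * Real.exp (-y) := by
    rw [Real.exp_neg, ← div_eq_mul_inv, ← one_div,
      div_le_div_iff₀ (Real.cosh_pos y) (Real.exp_pos y), Real.cosh_eq]
    linarith [Real.exp_pos (-y)]
  rw [Real.norm_of_nonneg (Real.rpow_nonneg h0.le a)]
  calc ((Real.cosh y)⁻¹) ^ a ≤ (2 * Real.exp (-y)) ^ a := Real.rpow_le_rpow h0.le h1 ha.le
    _ = 2 ^ a * Real.exp (-a * y) := by
      rw [Real.mul_rpow zero_le_two (Real.exp_pos _).le, ← Real.exp_mul]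
      ring_nf

theorem hasDerivAt_integral_Ioi_of_continuous {f : ℝ → ℝ} (hf : Continuous f)
    (hint : ∀ x, IntegrableOn f (Set.Ioi x)) (x : ℝ) :
    HasDerivAt (fun u => ∫ y in Set.Ioi u, f y) (-f x) x := by
  have h : (fun u => ∫ y in Set.Ioi u, f y) =
      fun u => (∫ y in Set.Ioi (0 : ℝ), f y) - ∫ y in (0 : ℝ)..u, f y := by
    funext u
    rw [eq_sub_iff_add_eq, add_comm]
    exact intervalIntegral.integral_interval_add_Ioi (hint 0) (hint u)
  rw [h]
  exact (hf.integral_hasStrictDerivAt 0 x).hasDerivAt.const_sub _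

theorem integral_Ioi_inv_cosh_rpow_pos {a : ℝ} (ha : 0 < a) (x : ℝ) :
    0 < ∫ y in Set.Ioi x, ((Real.cosh y)⁻¹) ^ a := by
  have hpos : ∀ y : ℝ, 0 < ((Real.cosh y)⁻¹) ^ a := fun y =>
    Real.rpow_pos_of_pos (inv_pos.2 (Real.cosh_pos y)) a
  rw [setIntegral_pos_iff_support_of_nonneg_ae (Eventually.of_forall fun y => (hpos y).le)
    (integrableOn_inv_cosh_rpow_Ioi ha x),
    Function.support_eq_univ fun y => (hpos y).ne', Set.univ_inter, Real.volume_Ioi]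
  exact ENNReal.zero_lt_top

theorem hasDerivAt_artanh_s16 {t : ℝ} (h₁ : -1 < t) (h₂ : t < 1) :
    HasDerivAt artanh (1 / (1 - t ^ 2)) t := by
  have ha : 1 + t ≠ 0 := by linarith
  have hb : 1 - t ≠ 0 := by linarith
  have hab : 1 - t ^ 2 ≠ 0 := by
    rw [show 1 - t ^ 2 = (1 + t) * (1 - t) by ring]
    exact mul_ne_zero ha hb
  have h := ((((hasDerivAt_id t).const_add 1).div ((hasDerivAt_id t).const_sub 1) hb).log
    (div_ne_zero ha hb)).const_mul (1 / 2 : ℝ)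
  refine h.congr_deriv ?_
  simp only [id, Pi.div_apply]
  rw [show 1 - t ^ 2 = (1 + t) * (1 - t) by ring]
  field_simp
  ring

/-- The derivative of `tauF` is a positive multiple of `α * m ^ 2 - γ * ω`. -/
theorem exists_hasDerivAt_tauF {m α γ ω : ℝ} (h : (γ - α * ω) ^ 2 < 4 * (m ^ 2 - ω ^ 2)) :
    ∃ c : ℝ, 0 < c ∧ HasDerivAt (tauF m α γ) (c * (α * m ^ 2 - γ * ω)) ω := by
  have hA : 0 < m ^ 2 - ω ^ 2 := by linarith [sq_nonneg (γ - α * ω)]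
  have hs : 0 < Real.sqrt (m ^ 2 - ω ^ 2) := Real.sqrt_pos.2 hA
  have hs2 : Real.sqrt (m ^ 2 - ω ^ 2) ^ 2 = m ^ 2 - ω ^ 2 := Real.sq_sqrt hA.le
  have hsq : HasDerivAt (fun w : ℝ => m ^ 2 - w ^ 2) (-(2 * ω)) ω := by
    simpa using (hasDerivAt_pow 2 ω).const_sub (m ^ 2)
  have hsqrt := (hsq.sqrt hA.ne').const_mul 2
  have hg : HasDerivAt (fun w : ℝ => -(γ - α * w)) α ω := by
    refine (((hasDerivAt_id ω).const_mul α).const_sub γ).neg.congr_deriv ?_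
    ring
  have ht := hg.div hsqrt (by positivity)
  set s := Real.sqrt (m ^ 2 - ω ^ 2)
  set t := -(γ - α * ω) / (2 * s) with ht_def
  have htabs : |t| < 1 := by
    rw [← sq_lt_one_iff_abs_lt_one, ht_def, div_pow, div_lt_one (by positivity)]
    nlinarith
  obtain ⟨h₁, h₂⟩ := abs_lt.1 htabs
  have ht2 : 0 < 1 - t ^ 2 := by
    have := (sq_lt_one_iff_abs_lt_one t).2 htabs
    linarith
  refine ⟨1 / (1 - t ^ 2) * (1 / (2 * s ^ 3)), by positivity, ?_⟩
  refine ((hasDerivAt_artanh_s16 h₁ h₂).comp ω ht).congr_deriv ?_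
  rw [mul_assoc]
  congr 1
  have hm2 : m ^ 2 = s ^ 2 + ω ^ 2 := by linarith
  rw [hm2]
  field_simp
  ring

/-- The derivative of the charge, with positive factors left unspecified. -/
theorem exists_hasDerivAt_QF {m p α γ ω : ℝ} (hp : 1 < p)
    (h : (γ - α * ω) ^ 2 < 4 * (m ^ 2 - ω ^ 2)) :
    ∃ a b c : ℝ, 0 < a ∧ 0 < b ∧ 0 < c ∧
      HasDerivAt (QF m p α γ)
        (-a * (m ^ 2 - 4 / (p - 1) * ω ^ 2) + b * (ω * (α * m ^ 2 - γ * ω)) -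
          c * (α * (α * γ - (4 + α ^ 2) * ω))) ω := by
  have hA : 0 < m ^ 2 - ω ^ 2 := by linarith [sq_nonneg (γ - α * ω)]
  have hD : 0 < 4 * (m ^ 2 - ω ^ 2) - (γ - α * ω) ^ 2 := by linarith
  have hp0 : 0 < p - 1 := by linarith
  have he : 0 < 4 / (p - 1) := by positivity
  have hK : 0 < ((p + 1) / 2) ^ (2 / (p - 1)) := Real.rpow_pos_of_pos (by linarith) _
  have hL : 0 < ((p + 1) / 8) ^ (2 / (p - 1)) := Real.rpow_pos_of_pos (by linarith) _
  have hcont : Continuous fun y : ℝ => ((Real.cosh y)⁻¹) ^ (4 / (p - 1)) :=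
    (Real.continuous_cosh.inv₀ fun y => (Real.cosh_pos y).ne').rpow_const fun _ => Or.inr he.le
  obtain ⟨k, hk, htau⟩ := exists_hasDerivAt_tauF h
  have hI := (hasDerivAt_integral_Ioi_of_continuous hcont
    (integrableOn_inv_cosh_rpow_Ioi he) (tauF m α γ ω)).comp ω htau
  have hIpos := integral_Ioi_inv_cosh_rpow_pos he (tauF m α γ ω)
  have hsech : 0 < ((Real.cosh (tauF m α γ ω))⁻¹) ^ (4 / (p - 1)) :=
    Real.rpow_pos_of_pos (inv_pos.2 (Real.cosh_pos _)) _
  have hsq : HasDerivAt (fun w : ℝ => m ^ 2 - w ^ 2) (-(2 * ω)) ω := by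
    simpa using (hasDerivAt_pow 2 ω).const_sub (m ^ 2)
  have hg : HasDerivAt (fun w : ℝ => γ - α * w) (-α) ω := by
    simpa using ((hasDerivAt_id ω).const_mul α).const_sub γ
  have hpow := hsq.rpow_const (p := 2 / (p - 1) - 1 / 2) (Or.inl hA.ne')
  have hC₁ := ((hasDerivAt_id ω).const_mul
    (-(4 / (p - 1)) * ((p + 1) / 2) ^ (2 / (p - 1)))).mul hpow
  have hC₂ := (((hsq.const_mul 4).sub (hg.pow 2)).rpow_const (p := 2 / (p - 1))
    (Or.inl hD.ne')).const_mul ((α / 2) * ((p + 1) / 8) ^ (2 / (p - 1)))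
  have hQ := (hC₁.mul hI).sub hC₂
  set K := ((p + 1) / 2) ^ (2 / (p - 1))
  set L := ((p + 1) / 8) ^ (2 / (p - 1))
  set S := ((Real.cosh (tauF m α γ ω))⁻¹) ^ (4 / (p - 1))
  have hB : 0 < (m ^ 2 - ω ^ 2) ^ (2 / (p - 1) - 1 / 2 - 1) := Real.rpow_pos_of_pos hA _
  have hE : 0 < (4 * (m ^ 2 - ω ^ 2) - (γ - α * ω) ^ 2) ^ (2 / (p - 1) - 1) :=
    Real.rpow_pos_of_pos hD _
  have hBA : (m ^ 2 - ω ^ 2) ^ (2 / (p - 1) - 1 / 2) =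
      (m ^ 2 - ω ^ 2) ^ (2 / (p - 1) - 1 / 2 - 1) * (m ^ 2 - ω ^ 2) := by
    rw [← Real.rpow_add_one hA.ne']
    ring_nf
  refine ⟨4 / (p - 1) * K * (m ^ 2 - ω ^ 2) ^ (2 / (p - 1) - 1 / 2 - 1) *
      ∫ y in Set.Ioi (tauF m α γ ω), ((Real.cosh y)⁻¹) ^ (4 / (p - 1)),
    4 / (p - 1) * K * (m ^ 2 - ω ^ 2) ^ (2 / (p - 1) - 1 / 2) * S * k,
    2 / (p - 1) * L * (4 * (m ^ 2 - ω ^ 2) - (γ - α * ω) ^ 2) ^ (2 / (p - 1) - 1),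
    by positivity, ?_, by positivity, ?_⟩
  · rw [hBA]
    positivity
  refine HasDerivAt.congr_deriv (f := QF m p α γ) hQ ?_
  simp only [id, Function.comp_apply, Pi.mul_apply, Pi.sub_apply, Pi.pow_apply]
  rw [hBA]
  set B := (m ^ 2 - ω ^ 2) ^ (2 / (p - 1) - 1 / 2 - 1)
  set E := (4 * (m ^ 2 - ω ^ 2) - (γ - α * ω) ^ 2) ^ (2 / (p - 1) - 1)
  set J := ∫ y in Set.Ioi (tauF m α γ ω), ((Real.cosh y)⁻¹) ^ (4 / (p - 1))
  field_simp
  push_cast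
  ring

theorem stmt_16 (m p α γ : ℝ) (hm : 0 < m) (hp₁ : 1 < p) (hp₅ : p < 5)
    (hα : α < 0) (hγ : γ < 0) :
    (∀ ω : ℝ, 0 < ω → ω < m / 2 * Real.sqrt (p - 1) →
      α * γ / (4 + α ^ 2) < ω → ω < α * m ^ 2 / γ →
      (γ - α * ω) ^ 2 < 4 * (m ^ 2 - ω ^ 2) →
      ∃ d : ℝ, HasDerivAt (QF m p α γ) d ω ∧ d < 0) ∧
    (∀ ω : ℝ, α * m ^ 2 / γ < ω → ω < α * γ / (4 + α ^ 2) →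
      m / 2 * Real.sqrt (p - 1) < ω → ω < m →
      (γ - α * ω) ^ 2 < 4 * (m ^ 2 - ω ^ 2) →
      ∃ d : ℝ, HasDerivAt (QF m p α γ) d ω ∧ 0 < d) := by
  have hp0 : 0 < p - 1 := by linarith
  have hα2 : 0 < 4 + α ^ 2 := by positivity
  have hr : 0 < m / 2 * Real.sqrt (p - 1) :=
    mul_pos (by linarith) (Real.sqrt_pos.2 hp0)
  have hr2 : (m / 2 * Real.sqrt (p - 1)) ^ 2 = m ^ 2 * (p - 1) / 4 := by
    rw [mul_pow, Real.sq_sqrt hp0.le]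
    ring
  constructor
  · intro ω hω h₁ h₂ h₃ hD
    obtain ⟨a, b, c, ha, hb, hc, hQ⟩ := exists_hasDerivAt_QF hp₁ hD
    refine ⟨_, hQ, ?_⟩
    rw [div_lt_iff₀ hα2] at h₂
    rw [lt_div_iff_of_neg hγ] at h₃
    have e₁ : 0 < m ^ 2 - 4 / (p - 1) * ω ^ 2 := by
      have : ω ^ 2 < m ^ 2 * (p - 1) / 4 := hr2 ▸ pow_lt_pow_left₀ h₁ hω.le two_ne_zero
      rw [sub_pos, div_mul_eq_mul_div, div_lt_iff₀ hp0]
      linarith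
    have t₁ := mul_pos ha e₁
    have t₂ := mul_pos hb (mul_pos hω (show 0 < γ * ω - α * m ^ 2 by linarith))
    have t₃ := mul_pos hc (mul_pos_of_neg_of_neg hα
      (show α * γ - (4 + α ^ 2) * ω < 0 by linarith))
    linarith
  · intro ω h₁ h₂ h₃ _ hD
    obtain ⟨a, b, c, ha, hb, hc, hQ⟩ := exists_hasDerivAt_QF hp₁ hD
    refine ⟨_, hQ, ?_⟩
    have hω : 0 < ω := hr.trans h₃
    rw [lt_div_iff₀ hα2] at h₂
    rw [div_lt_iff_of_neg hγ] at h₁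
    have e₁ : m ^ 2 - 4 / (p - 1) * ω ^ 2 < 0 := by
      have : m ^ 2 * (p - 1) / 4 < ω ^ 2 := hr2 ▸ pow_lt_pow_left₀ h₃ hr.le two_ne_zero
      rw [sub_neg, div_mul_eq_mul_div, lt_div_iff₀ hp0]
      linarith
    have t₁ := mul_neg_of_pos_of_neg ha e₁
    have t₂ := mul_pos hb (mul_pos hω (show 0 < α * m ^ 2 - γ * ω by linarith))
    have t₃ := mul_neg_of_pos_of_neg hc (mul_neg_of_neg_of_pos hα
      (show 0 < α * γ - (4 + α ^ 2) * ω by linarith))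
    linarith
end

section
/- Let m > 0 and γ ∈ ℝ with |γ| < 2m, and define q : (−m, m) → ℝ by q(ω) = −4ω√(m²−ω²) − 2γω. Set ω̃_γ = m√(1/2 + γ/(√(γ²+32m²)+γ)). Then for every ω ∈ (−m, m): the derivative q'(ω) is negative if |ω| < ω̃_γ and positive if |ω| > ω̃_γ. -/
open Filter Set Topology

/-- The derivative of the charge `ω ↦ -4ω√(m² - ω²) - 2γω`, with `s = √(m² - ω²)`. -/
theorem hasDerivAt_charge {m γ ω : ℝ} (h : 0 < m ^ 2 - ω ^ 2) :
    HasDerivAt (fun w : ℝ => -4 * w * Real.sqrt (m ^ 2 - w ^ 2) - 2 * γ * w)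
      ((4 * m ^ 2 - 2 * γ * Real.sqrt (m ^ 2 - ω ^ 2) - 8 * Real.sqrt (m ^ 2 - ω ^ 2) ^ 2) /
        Real.sqrt (m ^ 2 - ω ^ 2)) ω := by
  have hs : 0 < Real.sqrt (m ^ 2 - ω ^ 2) := Real.sqrt_pos.mpr h
  have hsq : Real.sqrt (m ^ 2 - ω ^ 2) ^ 2 = m ^ 2 - ω ^ 2 := Real.sq_sqrt h.le
  have hsqrt := (((hasDerivAt_id' ω).pow 2).const_sub (m ^ 2)).sqrt h.ne'
  have hd := (((hasDerivAt_id' ω).const_mul (-4)).mul hsqrt).sub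
    ((hasDerivAt_id' ω).const_mul (2 * γ))
  refine hd.congr_deriv ?_
  generalize Real.sqrt (m ^ 2 - ω ^ 2) = s at hs hsq
  field_simp
  norm_num
  linear_combination 8 * hsq

/-- The positive root `c` of `4c² + γc = 2m²`, and the critical frequency expressed through it. -/
theorem exists_critical_root {m : ℝ} (γ : ℝ) (hm : 0 < m) :
    ∃ c : ℝ, 0 < c ∧ 4 * c ^ 2 + γ * c = 2 * m ^ 2 ∧
      m ^ 2 * (1 / 2 + γ / (Real.sqrt (γ ^ 2 + 32 * m ^ 2) + γ)) = m ^ 2 - c ^ 2 := by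
  have hR : Real.sqrt (γ ^ 2 + 32 * m ^ 2) ^ 2 = γ ^ 2 + 32 * m ^ 2 :=
    Real.sq_sqrt (by positivity)
  have habs : |γ| < Real.sqrt (γ ^ 2 + 32 * m ^ 2) :=
    Real.lt_sqrt_of_sq_lt (by rw [sq_abs]; nlinarith [pow_pos hm 2])
  obtain ⟨h₁, h₂⟩ := abs_lt.mp habs
  generalize Real.sqrt (γ ^ 2 + 32 * m ^ 2) = R at hR h₁ h₂ ⊢
  have hpos : 0 < R + γ := by linarith
  have hm2 : m ^ 2 = (R - γ) * (R + γ) / 32 := by linear_combination (-1 / 32) * hR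
  refine ⟨(R - γ) / 8, by linarith, by linear_combination hR / 16, ?_⟩
  rw [hm2]
  field_simp
  ring

theorem stmt_17 (m γ : ℝ) (hm : 0 < m) (hγ : |γ| < 2 * m) :
    ∀ ω : ℝ, -m < ω → ω < m →
      (|ω| < m * Real.sqrt (1 / 2 + γ / (Real.sqrt (γ ^ 2 + 32 * m ^ 2) + γ)) →
        ∃ d : ℝ,
          HasDerivAt (fun w : ℝ => -4 * w * Real.sqrt (m ^ 2 - w ^ 2) - 2 * γ * w) d ω ∧
          d < 0) ∧
      (m * Real.sqrt (1 / 2 + γ / (Real.sqrt (γ ^ 2 + 32 * m ^ 2) + γ)) < |ω| →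
        ∃ d : ℝ,
          HasDerivAt (fun w : ℝ => -4 * w * Real.sqrt (m ^ 2 - w ^ 2) - 2 * γ * w) d ω ∧
          0 < d) := by
  intro ω h₁ h₂
  have hpos : 0 < m ^ 2 - ω ^ 2 := by nlinarith
  have hderiv := hasDerivAt_charge (γ := γ) hpos
  obtain ⟨c, hc, hroot, hcrit⟩ := exists_critical_root γ hm
  have hs : 0 < Real.sqrt (m ^ 2 - ω ^ 2) := Real.sqrt_pos.mpr hpos
  have hsq : Real.sqrt (m ^ 2 - ω ^ 2) ^ 2 = m ^ 2 - ω ^ 2 := Real.sq_sqrt hpos.le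
  have hthreshold : m * Real.sqrt (1 / 2 + γ / (Real.sqrt (γ ^ 2 + 32 * m ^ 2) + γ)) =
      Real.sqrt (m ^ 2 - c ^ 2) := by
    rw [← hcrit, Real.sqrt_mul (sq_nonneg m), Real.sqrt_sq hm.le]
  rw [hthreshold]
  generalize Real.sqrt (m ^ 2 - ω ^ 2) = s at hs hsq hderiv
  have hfactor : c * (4 * m ^ 2 - 2 * γ * s - 8 * s ^ 2) = 4 * (c - s) * (m ^ 2 + 2 * c * s) := by
    linear_combination (-2 * s) * hroot
  have hfac : 0 < m ^ 2 + 2 * c * s := by positivity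
  refine ⟨fun h => ⟨_, hderiv, div_neg_of_neg_of_pos ?_ hs⟩,
    fun h => ⟨_, hderiv, div_pos ?_ hs⟩⟩
  · have hlt := (Real.lt_sqrt (abs_nonneg ω)).mp h
    rw [sq_abs] at hlt
    have hcs : c < s := lt_of_pow_lt_pow_left₀ 2 hs.le (by linarith)
    have hneg : (c - s) * (m ^ 2 + 2 * c * s) < 0 := mul_neg_of_neg_of_pos (by linarith) hfac
    exact neg_of_mul_neg_right (a := c) (by linarith) hc.le
  · have hlt := Real.lt_sq_of_sqrt_lt h
    rw [sq_abs] at hlt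
    have hsc : s < c := lt_of_pow_lt_pow_left₀ 2 hc.le (by linarith)
    have hprod : 0 < (c - s) * (m ^ 2 + 2 * c * s) := mul_pos (by linarith) hfac
    exact pos_of_mul_pos_right (a := c) (by linarith) hc.le
end
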